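/- Consider the plane-wave metric g = -2du(dv + p_{ij}(u)x^i x^j du) + δ_{ij}dx^i dx^j on ℝ^{d+2}, where p_{ij} = p_{ji} are smooth functions of u (i,j = 2,…,d+1). Then the only possibly non-vanishing components of its Riemann curvature tensor in the coordinate frame are (up to the symmetries of the curvature tensor) R_{uiuj} = 2p_{ij}(u), and (ℝ^{d+2}, g) is proper second-order symmetric (∇∇R = 0, ∇R ≠ 0) if and only if every p_{ij} is an affine function of u, p_{ij}(u) = α_{ij}u + β_{ij}, with Σ_{i,j}(α_{ij})² ≠ 0. -/

import Mathlib

/-!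
Core framework: coordinate tensor calculus on `ℝⁿ` (partial derivatives, Christoffel
symbols, Riemann curvature, iterated covariant derivatives `∇ʳR`), and a notion of
pseudo-Riemannian manifold given by an atlas of metric charts whose transition
functions are smooth isometries.
-/

noncomputable section

open Matrix Set

/-- Partial derivative in the `i`-th coordinate direction. -/
def pd {n : ℕ} (i : Fin n) (f : (Fin n → ℝ) → ℝ) (x : Fin n → ℝ) : ℝ :=
  fderiv ℝ f x (Pi.single i 1)

/-- A metric in coordinates: a matrix-valued function on (an open subset of) `ℝⁿ`. -/
abbrev MetricMat (n : ℕ) := (Fin n → ℝ) → Matrix (Fin n) (Fin n) ℝ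

/-- Christoffel symbols `Γ^k_{ij}` of a coordinate metric. -/
def christoffel {n : ℕ} (g : MetricMat n) (x : Fin n → ℝ) (k i j : Fin n) : ℝ :=
  (1 / 2) * ∑ l, (g x)⁻¹ k l *
    (pd i (fun y => g y l j) x + pd j (fun y => g y l i) x - pd l (fun y => g y i j) x)

/-- Curvature tensor `R^l_{kij}` (1,3) of a coordinate metric. -/
def curvUp {n : ℕ} (g : MetricMat n) (x : Fin n → ℝ) (l k i j : Fin n) : ℝ :=
  pd i (fun y => christoffel g y l j k) x - pd j (fun y => christoffel g y l i k) x
    + ∑ m, christoffel g x l i m * christoffel g x m j k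
    - ∑ m, christoffel g x l j m * christoffel g x m i k

/-- Covariant tensor fields of valence `s` in coordinates. -/
abbrev TensorField (n s : ℕ) := (Fin n → ℝ) → (Fin s → Fin n) → ℝ

/-- The (0,4) Riemann curvature tensor `R_{lkij} = g_{lm} R^m_{kij}`. -/
def riemann {n : ℕ} (g : MetricMat n) : TensorField n 4 := fun x idx =>
  ∑ m, g x (idx 0) m * curvUp g x m (idx 1) (idx 2) (idx 3)

/-- The Ricci tensor `R_{ij} = R^m_{imj}`. -/
def ricci {n : ℕ} (g : MetricMat n) (x : Fin n → ℝ) (i j : Fin n) : ℝ :=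
  ∑ m, curvUp g x m i m j

/-- Covariant derivative of a covariant tensor field; the new (derivative) index is slot `0`. -/
def covDeriv {n s : ℕ} (g : MetricMat n) (T : TensorField n s) : TensorField n (s + 1) :=
  fun x idx =>
    pd (idx 0) (fun y => T y fun a => idx a.succ) x
      - ∑ a : Fin s, ∑ e, christoffel g x e (idx 0) (idx a.succ)
          * T x (Function.update (fun b : Fin s => idx b.succ) a e)

/-- Iterated covariant derivative `∇ʳ R` of the curvature tensor. -/
def nablaR {n : ℕ} (g : MetricMat n) : (r : ℕ) → TensorField n (4 + r)
  | 0 => riemann g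
  | r + 1 => covDeriv g (nablaR g r)

/-- `∇ʳ R = 0` on `U` (`r`-th symmetry in coordinates). -/
def RthSymmetricOn {n : ℕ} (g : MetricMat n) (U : Set (Fin n → ℝ)) (r : ℕ) : Prop :=
  ∀ x ∈ U, ∀ idx, nablaR g r x idx = 0

/-- Vanishing curvature (flatness) on `U`. -/
def FlatOn {n : ℕ} (g : MetricMat n) (U : Set (Fin n → ℝ)) : Prop :=
  ∀ x ∈ U, ∀ idx, riemann g x idx = 0

/-- A symmetric matrix is of Lorentzian signature `(-,+,…,+)` iff it is congruent to
`diag(-1,1,…,1)`. -/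
def IsLorentzMat {n : ℕ} (A : Matrix (Fin n) (Fin n) ℝ) : Prop :=
  ∃ P : Matrix (Fin n) (Fin n) ℝ, IsUnit P.det ∧
    Pᵀ * A * P = Matrix.diagonal fun i : Fin n => if (i : ℕ) = 0 then (-1 : ℝ) else 1

/-- `τ` is smooth on `S` and pulls the metric `g₂` back to the metric `g₁` there. -/
def IsPullbackIsometry {n m : ℕ} (g₁ : MetricMat n) (g₂ : MetricMat m)
    (τ : (Fin n → ℝ) → Fin m → ℝ) (S : Set (Fin n → ℝ)) : Prop :=
  (∀ a : Fin m, ContDiffOn ℝ (⊤ : ℕ∞) (fun y => τ y a) S) ∧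
  ∀ x ∈ S, ∀ i j : Fin n,
    g₁ x i j = ∑ a, ∑ b, g₂ (τ x) a b * pd i (fun y => τ y a) x * pd j (fun y => τ y b) x

/-- A metric chart on a topological space `M`: a homeomorphism of an open set of `M` onto
an open set of `ℝⁿ`, together with the coordinate expression of the metric tensor. -/
structure MetricChart (n : ℕ) (M : Type) [TopologicalSpace M] where
  dom : Set M
  open_dom : IsOpen dom
  φ : M → Fin n → ℝ
  ψ : (Fin n → ℝ) → M
  ran : Set (Fin n → ℝ)
  open_ran : IsOpen ran
  maps_to : ∀ p ∈ dom, φ p ∈ ran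
  maps_from : ∀ x ∈ ran, ψ x ∈ dom
  left_inv : ∀ p ∈ dom, ψ (φ p) = p
  right_inv : ∀ x ∈ ran, φ (ψ x) = x
  cont_phi : ContinuousOn φ dom
  cont_psi : ContinuousOn ψ ran
  g : MetricMat n
  smooth_g : ∀ a b : Fin n, ContDiffOn ℝ (⊤ : ℕ∞) (fun x => g x a b) ran
  symm_g : ∀ x ∈ ran, (g x).IsSymm
  nondeg_g : ∀ x ∈ ran, IsUnit (g x).det

/-- An `n`-dimensional pseudo-Riemannian manifold: a topological space covered by metric
charts whose transition functions are (smooth) isometries for the chart metrics. -/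
structure PRManifold (n : ℕ) where
  M : Type
  top : TopologicalSpace M
  chartAt : M → @MetricChart n M top
  mem_chart : ∀ p : M, p ∈ (chartAt p).dom
  compatible : ∀ p q : M,
    IsPullbackIsometry (chartAt p).g (chartAt q).g ((chartAt q).φ ∘ (chartAt p).ψ)
      ((chartAt p).φ '' ((chartAt p).dom ∩ (chartAt q).dom))

attribute [instance] PRManifold.top

namespace PRManifold

variable {n : ℕ}

/-- The metric is Lorentzian, of signature `(-,+,…,+)`. -/
def IsLorentzian (X : PRManifold n) : Prop :=
  ∀ p : X.M, ∀ x ∈ (X.chartAt p).ran, IsLorentzMat ((X.chartAt p).g x)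

/-- The metric is Riemannian (positive definite). -/
def IsRiemannian (X : PRManifold n) : Prop :=
  ∀ p : X.M, ∀ x ∈ (X.chartAt p).ran, ((X.chartAt p).g x).PosDef

/-- Connectedness of the underlying space. -/
def Conn (X : PRManifold n) : Prop := ConnectedSpace X.M

/-- Simple connectedness of the underlying space. -/
def SimplyConn (X : PRManifold n) : Prop := SimplyConnectedSpace X.M

/-- `∇ʳ R = 0` (in every chart). -/
def RthSymmetric (X : PRManifold n) (r : ℕ) : Prop :=
  ∀ p : X.M, RthSymmetricOn (X.chartAt p).g (X.chartAt p).ran r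

/-- `∇ʳ R = 0` but `∇^{r-1} R ≠ 0`. -/
def ProperRthSymmetric (X : PRManifold n) (r : ℕ) : Prop :=
  X.RthSymmetric r ∧ ¬ X.RthSymmetric (r - 1)

/-- The curvature tensor vanishes identically. -/
def Flat (X : PRManifold n) : Prop :=
  ∀ p : X.M, FlatOn (X.chartAt p).g (X.chartAt p).ran

/-- The Ricci tensor vanishes identically. -/
def RicciFlat (X : PRManifold n) : Prop :=
  ∀ p : X.M, ∀ x ∈ (X.chartAt p).ran, ∀ i j, ricci (X.chartAt p).g x i j = 0

end PRManifold

/-- A curve `c` (written in coordinates) is a geodesic of `g` on the parameter set `I`: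
its components are twice differentiable and satisfy the geodesic equations. -/
def IsGeodesicCurve {n : ℕ} (g : MetricMat n) (I : Set ℝ) (c : ℝ → Fin n → ℝ) : Prop :=
  ∀ t ∈ I, ∀ k : Fin n,
    DifferentiableAt ℝ (fun s => c s k) t ∧
    DifferentiableAt ℝ (deriv fun s => c s k) t ∧
    deriv (deriv fun s => c s k) t
      + ∑ i, ∑ j, christoffel g (c t) k i j * deriv (fun s => c s i) t
          * deriv (fun s => c s j) t = 0

namespace PRManifold

variable {n : ℕ}

/-- `γ` is a geodesic of `X` on the parameter set `I`: around each parameter it lies in a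
chart and its coordinate expression solves the geodesic equations there. -/
def IsGeodesic (X : PRManifold n) (I : Set ℝ) (γ : ℝ → X.M) : Prop :=
  ∀ t ∈ I, ∃ p : X.M, ∃ ε > (0 : ℝ),
    (∀ s ∈ I ∩ Set.Ioo (t - ε) (t + ε), γ s ∈ (X.chartAt p).dom) ∧
    IsGeodesicCurve (X.chartAt p).g (I ∩ Set.Ioo (t - ε) (t + ε))
      (fun s => (X.chartAt p).φ (γ s))

/-- Geodesic completeness: every (nontrivial) geodesic defined on an open interval
extends to a geodesic defined on all of `ℝ`. -/
def GeodesicallyComplete (X : PRManifold n) : Prop :=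
  ∀ (a b : ℝ) (γ : ℝ → X.M), (Set.Ioo a b).Nonempty → X.IsGeodesic (Set.Ioo a b) γ →
    ∃ γ' : ℝ → X.M, X.IsGeodesic Set.univ γ' ∧ ∀ t ∈ Set.Ioo a b, γ' t = γ t

end PRManifold

/-- First block of coordinates of a product. -/
def split1 {n₁ n₂ : ℕ} (x : Fin (n₁ + n₂) → ℝ) : Fin n₁ → ℝ := fun i => x (Fin.castAdd n₂ i)

/-- Second block of coordinates of a product. -/
def split2 {n₁ n₂ : ℕ} (x : Fin (n₁ + n₂) → ℝ) : Fin n₂ → ℝ := fun j => x (Fin.natAdd n₁ j)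

/-- The direct-product (block diagonal) metric `g₁ ⊕ g₂` in coordinates. -/
def prodMetricMat {n₁ n₂ : ℕ} (G₁ : MetricMat n₁) (G₂ : MetricMat n₂) :
    MetricMat (n₁ + n₂) := fun x =>
  (Matrix.fromBlocks (G₁ (split1 x)) 0 0 (G₂ (split2 x))).submatrix
    finSumFinEquiv.symm finSumFinEquiv.symm

/-- The (generalized Cahen–Wallach / plane-wave) metric
`g = -2du(dv + P_{ij}(u)xⁱxʲ du) + δ_{ij} dxⁱ dxʲ` on `ℝ^{e+2}`,
with coordinates `x 0 = u`, `x 1 = v` and spatial coordinates `x i.succ.succ`. -/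
def cwMetric (e : ℕ) (P : ℝ → Matrix (Fin e) (Fin e) ℝ) : MetricMat (e + 2) := fun x k l =>
  (if k = 0 ∧ l = 0 then (-2) * ∑ i, ∑ j, P (x 0) i j * x i.succ.succ * x j.succ.succ else 0)
  + (if (k = 0 ∧ l = 1) ∨ (k = 1 ∧ l = 0) then -1 else 0)
  + (if k = l ∧ 2 ≤ (k : ℕ) then 1 else 0)

/-- The Brinkmann metric `ds² = -2du(dv + H du + Wᵢ dxⁱ) + g_{ij} dxⁱ dxʲ` on `ℝ^{d+2}`,
with coordinates `x 0 = u`, `x 1 = v` and spatial coordinates `x i.succ.succ`. -/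
def brinkmannMat (d : ℕ) (H : (Fin (d + 2) → ℝ) → ℝ) (W : Fin d → (Fin (d + 2) → ℝ) → ℝ)
    (gs : (Fin (d + 2) → ℝ) → Matrix (Fin d) (Fin d) ℝ) : MetricMat (d + 2) := fun x k l =>
  (if k = 0 ∧ l = 0 then (-2) * H x else 0)
  + (if (k = 0 ∧ l = 1) ∨ (k = 1 ∧ l = 0) then -1 else 0)
  + (if k = 0 then ∑ i : Fin d, if l = i.succ.succ then -(W i x) else 0 else 0)
  + (if l = 0 then ∑ i : Fin d, if k = i.succ.succ then -(W i x) else 0 else 0)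
  + ∑ i : Fin d, ∑ j : Fin d, if k = i.succ.succ ∧ l = j.succ.succ then gs x i j else 0

/-- A function on `ℝ^{d+2}` is independent of the coordinate `v = x 1`. -/
def vIndep {d : ℕ} {α : Type*} (f : (Fin (d + 2) → ℝ) → α) : Prop :=
  ∀ x t, f (Function.update x (1 : Fin (d + 2)) t) = f x

/-- The point of `ℝ^{d+2}` with `u`, `v` and spatial coordinates `u`, `v`, `y`. -/
def emb (d : ℕ) (u v : ℝ) (y : Fin d → ℝ) : Fin (d + 2) → ℝ :=
  Fin.cons u (Fin.cons v y)
-- extension layer (appended to core for testing)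
namespace PRManifold

variable {n : ℕ}

/-- A self-map of `Y` is a (global) isometry: it is a homeomorphism and, read in the
charts, it pulls the metric back to the metric. -/
def IsAutoIsometry (Y : PRManifold n) (σ : Y.M → Y.M) : Prop :=
  Function.Bijective σ ∧ Continuous σ ∧
    ∀ q : Y.M, ∃ S, IsOpen S ∧ (Y.chartAt q).φ q ∈ S ∧ S ⊆ (Y.chartAt q).ran ∧
      (∀ x ∈ S, σ ((Y.chartAt q).ψ x) ∈ (Y.chartAt (σ q)).dom) ∧
      IsPullbackIsometry (Y.chartAt q).g (Y.chartAt (σ q)).g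
        (fun x => (Y.chartAt (σ q)).φ (σ ((Y.chartAt q).ψ x))) S

/-- `Y` is a (globally) symmetric space: the geodesic symmetry at every point extends to
a global isometry, i.e. every point is an isolated fixed point of a global isometry whose
differential there is `-id` (in chart coordinates). -/
def IsSymmetricSpace (Y : PRManifold n) : Prop :=
  ∀ q : Y.M, ∃ σ : Y.M → Y.M, Y.IsAutoIsometry σ ∧ σ q = q ∧
    ∀ a i : Fin n,
      pd i (fun x => (Y.chartAt (σ q)).φ (σ ((Y.chartAt q).ψ x)) a) ((Y.chartAt q).φ q)
        = -(if i = a then 1 else 0)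

/-- The metric of `X` is real-analytic: around every point there are coordinates in which
the metric components are real-analytic functions. -/
def AnalyticMetric (X : PRManifold n) : Prop :=
  ∀ p : X.M, ∃ S, IsOpen S ∧ (X.chartAt p).φ p ∈ S ∧ S ⊆ (X.chartAt p).ran ∧
    ∃ (τ : (Fin n → ℝ) → Fin n → ℝ) (G : MetricMat n),
      Set.InjOn τ S ∧ (∀ a b : Fin n, AnalyticOnNhd ℝ (fun y => G y a b) (τ '' S)) ∧
      IsPullbackIsometry (X.chartAt p).g G τ S

end PRManifold

/-- `Z` is globally isometric to the direct product `X × Y` (with the product metric):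
there is a bijection which, read in charts, is an isometry onto the product. -/
def GloballyIsometricToProd {n₀ n₁ n₂ : ℕ} (Z : PRManifold n₀)
    (X : PRManifold n₁) (Y : PRManifold n₂) : Prop :=
  ∃ F : Z.M → X.M × Y.M, Function.Bijective F ∧
    ∀ p : Z.M, ∃ S, IsOpen S ∧ (Z.chartAt p).φ p ∈ S ∧ S ⊆ (Z.chartAt p).ran ∧
      (∀ x ∈ S, (F ((Z.chartAt p).ψ x)).1 ∈ (X.chartAt (F p).1).dom
        ∧ (F ((Z.chartAt p).ψ x)).2 ∈ (Y.chartAt (F p).2).dom) ∧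
      IsPullbackIsometry (Z.chartAt p).g
        (prodMetricMat (X.chartAt (F p).1).g (Y.chartAt (F p).2).g)
        (fun x => Fin.append ((X.chartAt (F p).1).φ (F ((Z.chartAt p).ψ x)).1)
          ((Y.chartAt (F p).2).φ (F ((Z.chartAt p).ψ x)).2)) S

/-- `X` is globally isometric to the direct product of the coordinate spacetime
`(ℝ^{e+2}, Gcw)` and `Y` (with the product metric). -/
def GloballyIsometricToCWProd {n e m : ℕ} (X : PRManifold n) (Gcw : MetricMat (e + 2))
    (Y : PRManifold m) : Prop :=
  ∃ F : X.M → (Fin (e + 2) → ℝ) × Y.M, Function.Bijective F ∧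
    ∀ p : X.M, ∃ S, IsOpen S ∧ (X.chartAt p).φ p ∈ S ∧ S ⊆ (X.chartAt p).ran ∧
      (∀ x ∈ S, (F ((X.chartAt p).ψ x)).2 ∈ (Y.chartAt (F p).2).dom) ∧
      IsPullbackIsometry (X.chartAt p).g (prodMetricMat Gcw (Y.chartAt (F p).2).g)
        (fun x => Fin.append (F ((X.chartAt p).ψ x)).1
          ((Y.chartAt (F p).2).φ (F ((X.chartAt p).ψ x)).2)) S

/-- `X` is locally isometric to the direct product of the coordinate spacetime
`(ℝ^{e+2}, Gcw)` and `Y`: every point has a neighbourhood that maps isometrically into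
the product. -/
def LocallyIsometricToCWProd {n e m : ℕ} (X : PRManifold n) (Gcw : MetricMat (e + 2))
    (Y : PRManifold m) : Prop :=
  ∀ p : X.M, ∃ q : Y.M, ∃ S, IsOpen S ∧ (X.chartAt p).φ p ∈ S ∧ S ⊆ (X.chartAt p).ran ∧
    ∃ τ : (Fin n → ℝ) → Fin ((e + 2) + m) → ℝ,
      (∀ x ∈ S, split2 (n₁ := e + 2) (τ x) ∈ (Y.chartAt q).ran) ∧
      IsPullbackIsometry (X.chartAt p).g (prodMetricMat Gcw (Y.chartAt q).g) τ S

/-- An identification of `Σ i, Fin (m i)` with `Fin (∑ i, m i)`. -/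
def sigmaFinEquiv {k : ℕ} (m : Fin k → ℕ) : (Σ i : Fin k, Fin (m i)) ≃ Fin (∑ i, m i) :=
  (Fintype.equivFin _).trans (finCongr (by simp))

/-- The `i`-th block of coordinates in `ℝ^{∑ mdim}`. -/
def sigCoord {k : ℕ} {mdim : Fin k → ℕ} (x : Fin (∑ i, mdim i) → ℝ) (i : Fin k) :
    Fin (mdim i) → ℝ := fun a => x (sigmaFinEquiv mdim ⟨i, a⟩)

/-- The block-diagonal metric of a finite direct product, in coordinates. -/
def multiBlockMetric {k : ℕ} {mdim : Fin k → ℕ}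
    (G : (i : Fin k) → MetricMat (mdim i)) : MetricMat (∑ i, mdim i) := fun x a b =>
  let sa := (sigmaFinEquiv mdim).symm a
  let sb := (sigmaFinEquiv mdim).symm b
  if h : sa.1 = sb.1 then G sb.1 (sigCoord x sb.1) (h ▸ sa.2) sb.2 else 0

/-- `X` is globally isometric to the direct product of the coordinate spacetime
`(ℝ^d, Gcw)` with the finite family of manifolds `Y i` (with the product metric). -/
def GloballyIsometricToCWMultiProd {n d k : ℕ} {mdim : Fin k → ℕ}
    (X : PRManifold n) (Gcw : MetricMat d)
    (Y : (i : Fin k) → PRManifold (mdim i)) : Prop :=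
  ∃ F : X.M → (Fin d → ℝ) × ((i : Fin k) → (Y i).M), Function.Bijective F ∧
    ∀ p : X.M, ∃ S, IsOpen S ∧ (X.chartAt p).φ p ∈ S ∧ S ⊆ (X.chartAt p).ran ∧
      (∀ x ∈ S, ∀ i, (F ((X.chartAt p).ψ x)).2 i ∈ ((Y i).chartAt ((F p).2 i)).dom) ∧
      IsPullbackIsometry (X.chartAt p).g
        (prodMetricMat Gcw (multiBlockMetric fun i => ((Y i).chartAt ((F p).2 i)).g))
        (fun x => Fin.append (F ((X.chartAt p).ψ x)).1
          (fun j => let s := (sigmaFinEquiv mdim).symm j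
            ((Y s.1).chartAt ((F p).2 s.1)).φ ((F ((X.chartAt p).ψ x)).2 s.1) s.2)) S

/-- `X` is locally isometric to the direct product of the coordinate spacetime
`(ℝ^d, Gcw)` with the finite family of manifolds `Y i`. -/
def LocallyIsometricToCWMultiProd {n d k : ℕ} {mdim : Fin k → ℕ}
    (X : PRManifold n) (Gcw : MetricMat d)
    (Y : (i : Fin k) → PRManifold (mdim i)) : Prop :=
  ∀ p : X.M, ∃ q : (i : Fin k) → (Y i).M, ∃ S, IsOpen S ∧ (X.chartAt p).φ p ∈ S ∧
    S ⊆ (X.chartAt p).ran ∧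
    ∃ τ : (Fin n → ℝ) → Fin (d + ∑ i, mdim i) → ℝ,
      (∀ x ∈ S, ∀ i : Fin k,
        sigCoord (split2 (n₁ := d) (τ x)) i ∈ ((Y i).chartAt (q i)).ran) ∧
      IsPullbackIsometry (X.chartAt p).g
        (prodMetricMat Gcw (multiBlockMetric fun i => ((Y i).chartAt (q i)).g)) τ S

/-- `X'` (with projection `π`) is a universal covering of `X`, with the pulled-back
metric: `π` is a topological covering map, `X'` is simply connected and `π` is a local
isometry. -/
def IsUniversalCoverOf {n : ℕ} (X' X : PRManifold n) (π : X'.M → X.M) : Prop :=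
  IsCoveringMap π ∧ X'.SimplyConn ∧
    ∀ p : X'.M, ∃ S, IsOpen S ∧ (X'.chartAt p).φ p ∈ S ∧ S ⊆ (X'.chartAt p).ran ∧
      (∀ x ∈ S, π ((X'.chartAt p).ψ x) ∈ (X.chartAt (π p)).dom) ∧
      IsPullbackIsometry (X'.chartAt p).g (X.chartAt (π p)).g
        (fun x => (X.chartAt (π p)).φ (π ((X'.chartAt p).ψ x))) S

section PartialDerivatives

variable {n : ℕ}

lemma pd_const (i : Fin n) (c : ℝ) (x : Fin n → ℝ) : pd i (fun _ => c) x = 0 := by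
  simp [pd]

lemma pd_const_mul (i : Fin n) (c : ℝ) {f : (Fin n → ℝ) → ℝ} {x : Fin n → ℝ}
    (hf : DifferentiableAt ℝ f x) : pd i (fun y => c * f y) x = c * pd i f x := by
  simp [pd, fderiv_const_mul hf]

lemma pd_mul (i : Fin n) {f g : (Fin n → ℝ) → ℝ} {x : Fin n → ℝ}
    (hf : DifferentiableAt ℝ f x) (hg : DifferentiableAt ℝ g x) :
    pd i (fun y => f y * g y) x = f x * pd i g x + pd i f x * g x := by
  simp [pd, fderiv_fun_mul hf hg, mul_comm]

lemma pd_add (i : Fin n) {f g : (Fin n → ℝ) → ℝ} {x : Fin n → ℝ}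
    (hf : DifferentiableAt ℝ f x) (hg : DifferentiableAt ℝ g x) :
    pd i (fun y => f y + g y) x = pd i f x + pd i g x := by
  simp [pd, fderiv_fun_add hf hg]

lemma pd_sub (i : Fin n) {f g : (Fin n → ℝ) → ℝ} {x : Fin n → ℝ}
    (hf : DifferentiableAt ℝ f x) (hg : DifferentiableAt ℝ g x) :
    pd i (fun y => f y - g y) x = pd i f x - pd i g x := by
  simp [pd, fderiv_fun_sub hf hg]

lemma pd_sum {ι : Type*} [Fintype ι] (i : Fin n) {f : ι → (Fin n → ℝ) → ℝ} {x : Fin n → ℝ}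
    (hf : ∀ a, DifferentiableAt ℝ (f a) x) :
    pd i (fun y => ∑ a, f a y) x = ∑ a, pd i (f a) x := by
  simp [pd, fderiv_fun_sum fun a _ => hf a]

lemma pd_comp_coord (i j : Fin n) {f : ℝ → ℝ} {x : Fin n → ℝ}
    (hf : DifferentiableAt ℝ f (x j)) :
    pd i (fun y => f (y j)) x = if j = i then deriv f (x j) else 0 := by
  have h : HasFDerivAt (fun y : Fin n → ℝ => y j) (ContinuousLinearMap.proj (R := ℝ) j) x :=
    (ContinuousLinearMap.proj (R := ℝ) (φ := fun _ : Fin n => ℝ) j).hasFDerivAt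
  have h2 := hf.hasDerivAt.comp_hasFDerivAt x h
  have h3 : fderiv ℝ (fun y : Fin n → ℝ => f (y j)) x = _ := h2.fderiv
  simp [pd, h3, Pi.single_apply]

lemma pd_coord (i j : Fin n) (x : Fin n → ℝ) :
    pd i (fun y => y j) x = if j = i then 1 else 0 := by
  simpa using pd_comp_coord (f := fun t => t) i j (x := x) differentiableAt_fun_id

lemma pd_ite (i : Fin n) (p : Prop) [Decidable p] (f : (Fin n → ℝ) → ℝ) (x : Fin n → ℝ) :
    pd i (fun y => if p then f y else 0) x = if p then pd i f x else 0 := by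
  split_ifs <;> simp [pd_const]

lemma ContDiff.pd {f : (Fin n → ℝ) → ℝ} (hf : ContDiff ℝ (⊤ : ℕ∞) f) (i : Fin n) :
    ContDiff ℝ (⊤ : ℕ∞) (pd i f) :=
  (hf.fderiv_right (m := (⊤ : ℕ∞)) (by simp)).clm_apply contDiff_const

lemma pd_comm {f : (Fin n → ℝ) → ℝ} (hf : ContDiff ℝ (⊤ : ℕ∞) f) (i j : Fin n)
    (x : Fin n → ℝ) : pd i (pd j f) x = pd j (pd i f) x := by
  have hd : DifferentiableAt ℝ (fderiv ℝ f) x :=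
    ((hf.fderiv_right (m := (⊤ : ℕ∞)) (by simp)).differentiable (by simp)).differentiableAt
  have key (a b : Fin n) : pd a (pd b f) x
      = fderiv ℝ (fderiv ℝ f) x (Pi.single a 1) (Pi.single b 1) := by
    change fderiv ℝ (fun y => fderiv ℝ f y (Pi.single b 1)) x (Pi.single a 1) = _
    rw [fderiv_clm_apply hd (differentiableAt_const _)]
    simp
  rw [key, key]
  exact (hf.contDiffAt.isSymmSndFDerivAt (by simpa using WithTop.coe_le_coe.mpr (le_top : (2 : ℕ∞) ≤ ⊤))) _ _

end PartialDerivatives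

section PlaneWave

variable {e : ℕ}

/-- The profile function `H = p_{ij}(u) xⁱ xʲ` of a plane wave. -/
def waveProfile (P : ℝ → Matrix (Fin e) (Fin e) ℝ) (x : Fin (e + 2) → ℝ) : ℝ :=
  ∑ i, ∑ j, P (x 0) i j * x i.succ.succ * x j.succ.succ

variable {P : ℝ → Matrix (Fin e) (Fin e) ℝ}

lemma contDiff_comp_coord_zero {f : ℝ → ℝ} (hf : ContDiff ℝ (⊤ : ℕ∞) f) :
    ContDiff ℝ (⊤ : ℕ∞) fun x : Fin (e + 2) → ℝ => f (x 0) :=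
  hf.comp (contDiff_apply ℝ ℝ 0)

lemma contDiff_waveProfile (hP : ∀ i j, ContDiff ℝ (⊤ : ℕ∞) fun u => P u i j) :
    ContDiff ℝ (⊤ : ℕ∞) (waveProfile P) :=
  ContDiff.sum fun i _ => ContDiff.sum fun j _ =>
    ((contDiff_comp_coord_zero (hP i j)).mul (contDiff_apply ℝ ℝ _)).mul (contDiff_apply ℝ ℝ _)

lemma pd_waveProfile_one (hP : ∀ i j, ContDiff ℝ (⊤ : ℕ∞) fun u => P u i j) :
    pd 1 (waveProfile P) = fun _ => 0 := by
  funext x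
  have h0 (i j) : DifferentiableAt ℝ (fun y : Fin (e + 2) → ℝ => P (y 0) i j) x :=
    ((contDiff_comp_coord_zero (hP i j)).differentiable (by simp)).differentiableAt
  have h1 (i j) := (hP i j).differentiable (by simp) (x 0)
  unfold waveProfile
  rw [pd_sum _ fun i => by fun_prop]
  refine Finset.sum_eq_zero fun i _ => ?_
  rw [pd_sum _ fun j => by fun_prop]
  refine Finset.sum_eq_zero fun j _ => ?_
  rw [pd_mul _ (by fun_prop) (by fun_prop), pd_mul _ (by fun_prop) (by fun_prop),
    pd_comp_coord _ _ (h1 i j), pd_coord, pd_coord]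
  simp [Fin.ext_iff]

lemma pd_waveProfile_succ_succ (hP : ∀ i j, ContDiff ℝ (⊤ : ℕ∞) fun u => P u i j)
    (hPsym : ∀ u, (P u).IsSymm) (k : Fin e) :
    pd k.succ.succ (waveProfile P) = fun x => ∑ j, 2 * (P (x 0) k j * x j.succ.succ) := by
  funext x
  have h0 (i j) : DifferentiableAt ℝ (fun y : Fin (e + 2) → ℝ => P (y 0) i j) x :=
    ((contDiff_comp_coord_zero (hP i j)).differentiable (by simp)).differentiableAt
  have h1 (i j) := (hP i j).differentiable (by simp) (x 0)
  have hterm (i j : Fin e) :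
      pd k.succ.succ (fun y => P (y 0) i j * y i.succ.succ * y j.succ.succ) x
        = (if j = k then P (x 0) i k * x i.succ.succ else 0)
          + if i = k then P (x 0) k j * x j.succ.succ else 0 := by
    rw [pd_mul _ (by fun_prop) (by fun_prop), pd_mul _ (by fun_prop) (by fun_prop),
      pd_comp_coord _ _ (h1 i j), pd_coord, pd_coord]
    simp only [Fin.succ_inj]
    have : (0 : Fin (e + 2)) ≠ k.succ.succ := (Fin.succ_ne_zero _).symm
    split_ifs <;> simp_all
  have hsum : pd k.succ.succ (waveProfile P) x
      = ∑ i, ∑ j, ((if j = k then P (x 0) i k * x i.succ.succ else 0)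
          + if i = k then P (x 0) k j * x j.succ.succ else 0) := by
    unfold waveProfile
    rw [pd_sum _ fun i => by fun_prop]
    refine Finset.sum_congr rfl fun i _ => ?_
    rw [pd_sum _ fun j => by fun_prop]
    exact Finset.sum_congr rfl fun j _ => hterm i j
  rw [hsum]
  simp only [Finset.sum_add_distrib, Finset.sum_ite_eq', Finset.mem_univ, if_true]
  rw [Finset.sum_comm (f := fun i j => if i = k then P (x 0) k j * x j.succ.succ else 0)]
  simp only [Finset.sum_ite_eq', Finset.mem_univ, if_true, two_mul, Finset.sum_add_distrib]
  congr 1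
  exact Finset.sum_congr rfl fun i _ => by rw [(hPsym _).apply]

/-- The transverse Hessian of the profile is `2 p_{ij}`. -/
lemma pd_pd_waveProfile (hP : ∀ i j, ContDiff ℝ (⊤ : ℕ∞) fun u => P u i j)
    (hPsym : ∀ u, (P u).IsSymm) (i k : Fin e) (x : Fin (e + 2) → ℝ) :
    pd i.succ.succ (pd k.succ.succ (waveProfile P)) x = 2 * P (x 0) k i := by
  have h0 (i j) : DifferentiableAt ℝ (fun y : Fin (e + 2) → ℝ => P (y 0) i j) x :=
    ((contDiff_comp_coord_zero (hP i j)).differentiable (by simp)).differentiableAt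
  have h1 (i j) := (hP i j).differentiable (by simp) (x 0)
  rw [pd_waveProfile_succ_succ hP hPsym, pd_sum _ fun j => by fun_prop,
    Finset.sum_eq_single i]
  · rw [pd_const_mul _ _ (by fun_prop), pd_mul _ (by fun_prop) (by fun_prop),
      pd_comp_coord _ _ (h1 k i), pd_coord]
    simp [(Fin.succ_ne_zero _).symm]
  · intro j _ hj
    rw [pd_const_mul _ _ (by fun_prop), pd_mul _ (by fun_prop) (by fun_prop),
      pd_comp_coord _ _ (h1 k j), pd_coord]
    simp [hj, (Fin.succ_ne_zero _).symm]
  · simp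

lemma succ_succ_ne_one (k : Fin e) : k.succ.succ ≠ 1 := by
  simp [Fin.ext_iff]

lemma one_ne_succ_succ (k : Fin e) : 1 ≠ k.succ.succ := (succ_succ_ne_one k).symm

lemma zero_ne_succ_succ (k : Fin e) : 0 ≠ k.succ.succ := (Fin.succ_ne_zero _).symm

lemma cwMetric_apply (x : Fin (e + 2) → ℝ) (k l : Fin (e + 2)) :
    cwMetric e P x k l = (if k = 0 ∧ l = 0 then (-2) * waveProfile P x else 0)
      + (if (k = 0 ∧ l = 1) ∨ (k = 1 ∧ l = 0) then -1 else 0)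
      + (if k = l ∧ 2 ≤ (k : ℕ) then 1 else 0) := rfl

/-- The inverse of the plane-wave metric. -/
def cwInv (P : ℝ → Matrix (Fin e) (Fin e) ℝ) : MetricMat (e + 2) := fun x k l =>
  (if k = 1 ∧ l = 1 then 2 * waveProfile P x else 0)
  + (if (k = 0 ∧ l = 1) ∨ (k = 1 ∧ l = 0) then -1 else 0)
  + (if k = l ∧ 2 ≤ (k : ℕ) then 1 else 0)

lemma sum_cwMetric_zero (x : Fin (e + 2) → ℝ) (c : Fin (e + 2) → ℝ) :
    ∑ m, cwMetric e P x 0 m * c m = -2 * waveProfile P x * c 0 - c 1 := by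
  rw [Fin.sum_univ_succ, Fin.sum_univ_succ]
  simp [cwMetric_apply, succ_succ_ne_one, sub_eq_add_neg]

lemma sum_cwMetric_one (x : Fin (e + 2) → ℝ) (c : Fin (e + 2) → ℝ) :
    ∑ m, cwMetric e P x 1 m * c m = - c 0 := by
  rw [Fin.sum_univ_succ, Fin.sum_univ_succ]
  simp [cwMetric_apply]

lemma sum_cwMetric_succ_succ (x : Fin (e + 2) → ℝ) (s : Fin e) (c : Fin (e + 2) → ℝ) :
    ∑ m, cwMetric e P x s.succ.succ m * c m = c s.succ.succ := by
  rw [Fin.sum_univ_succ, Fin.sum_univ_succ]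
  simp [cwMetric_apply, succ_succ_ne_one]

lemma sum_cwInv_zero (x : Fin (e + 2) → ℝ) (c : Fin (e + 2) → ℝ) :
    ∑ m, cwInv P x 0 m * c m = - c 1 := by
  rw [Fin.sum_univ_succ, Fin.sum_univ_succ]
  simp [cwInv, succ_succ_ne_one]

lemma sum_cwInv_one (x : Fin (e + 2) → ℝ) (c : Fin (e + 2) → ℝ) :
    ∑ m, cwInv P x 1 m * c m = 2 * waveProfile P x * c 1 - c 0 := by
  rw [Fin.sum_univ_succ, Fin.sum_univ_succ]
  simp [cwInv, succ_succ_ne_one]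
  ring

lemma sum_cwInv_succ_succ (x : Fin (e + 2) → ℝ) (s : Fin e) (c : Fin (e + 2) → ℝ) :
    ∑ m, cwInv P x s.succ.succ m * c m = c s.succ.succ := by
  rw [Fin.sum_univ_succ, Fin.sum_univ_succ]
  simp [cwInv, succ_succ_ne_one]

lemma cwMetric_inv (x : Fin (e + 2) → ℝ) : (cwMetric e P x)⁻¹ = cwInv P x := by
  refine Matrix.inv_eq_right_inv ?_
  ext k l
  rw [Matrix.mul_apply]
  induction k using Fin.cases with
  | zero =>
    rw [sum_cwMetric_zero]
    induction l using Fin.cases with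
    | zero => simp [cwInv]
    | succ l => induction l using Fin.cases <;>
        simp [cwInv, succ_succ_ne_one, one_ne_succ_succ, zero_ne_succ_succ, Matrix.one_apply]
  | succ k => induction k using Fin.cases with
    | zero =>
      rw [Fin.succ_zero_eq_one, sum_cwMetric_one]
      induction l using Fin.cases with
      | zero => simp [cwInv]
      | succ l => induction l using Fin.cases <;>
          simp [cwInv, succ_succ_ne_one, one_ne_succ_succ, zero_ne_succ_succ, Matrix.one_apply]
    | succ k =>
      rw [sum_cwMetric_succ_succ]
      simp [cwInv, succ_succ_ne_one, Matrix.one_apply]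

lemma pd_cwMetric (hP : ∀ i j, ContDiff ℝ (⊤ : ℕ∞) fun u => P u i j)
    (i k l : Fin (e + 2)) (x : Fin (e + 2) → ℝ) :
    pd i (fun y => cwMetric e P y k l) x
      = if k = 0 ∧ l = 0 then -2 * pd i (waveProfile P) x else 0 := by
  have hd : DifferentiableAt ℝ (waveProfile P) x :=
    ((contDiff_waveProfile hP).differentiable (by simp)).differentiableAt
  simp only [cwMetric_apply, add_assoc]
  by_cases h : k = 0 ∧ l = 0
  · simp only [h, and_self, if_true]
    rw [pd_add _ (by fun_prop) (by fun_prop), pd_const_mul _ _ hd, pd_const, add_zero]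
  · simp only [h, if_false, pd_const]

lemma christoffel_zero (hP : ∀ i j, ContDiff ℝ (⊤ : ℕ∞) fun u => P u i j)
    (x : Fin (e + 2) → ℝ) (i j : Fin (e + 2)) : christoffel (cwMetric e P) x 0 i j = 0 := by
  simp only [christoffel, cwMetric_inv, sum_cwInv_zero, pd_cwMetric hP]
  simp [pd_waveProfile_one hP]

lemma christoffel_one (hP : ∀ i j, ContDiff ℝ (⊤ : ℕ∞) fun u => P u i j)
    (x : Fin (e + 2) → ℝ) (i j : Fin (e + 2)) :
    christoffel (cwMetric e P) x 1 i j
      = (if j = 0 then pd i (waveProfile P) x else 0)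
        + (if i = 0 then pd j (waveProfile P) x else 0)
        - (if i = 0 ∧ j = 0 then pd 0 (waveProfile P) x else 0) := by
  simp only [christoffel, cwMetric_inv, sum_cwInv_one, pd_cwMetric hP]
  by_cases hi : i = 0 <;> by_cases hj : j = 0 <;> simp [hi, hj, pd_waveProfile_one hP]

lemma christoffel_succ_succ (hP : ∀ i j, ContDiff ℝ (⊤ : ℕ∞) fun u => P u i j)
    (x : Fin (e + 2) → ℝ) (k : Fin e) (i j : Fin (e + 2)) :
    christoffel (cwMetric e P) x k.succ.succ i j
      = if i = 0 ∧ j = 0 then pd k.succ.succ (waveProfile P) x else 0 := by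
  simp only [christoffel, cwMetric_inv, sum_cwInv_succ_succ, pd_cwMetric hP]
  by_cases hi : i = 0 <;> by_cases hj : j = 0 <;> simp [hi, hj]

/-- Extension by zero of a matrix from the transverse indices to all coordinates. -/
def transverse (A : Matrix (Fin e) (Fin e) ℝ) (k l : Fin (e + 2)) : ℝ :=
  Fin.cases 0 (Fin.cases 0 fun a => Fin.cases 0 (Fin.cases 0 fun b => A a b) l) k

@[simp] lemma transverse_zero_left (A : Matrix (Fin e) (Fin e) ℝ) (l : Fin (e + 2)) :
    transverse A 0 l = 0 := rfl

@[simp] lemma transverse_one_left (A : Matrix (Fin e) (Fin e) ℝ) (l : Fin (e + 2)) :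
    transverse A 1 l = 0 := rfl

@[simp] lemma transverse_zero_right (A : Matrix (Fin e) (Fin e) ℝ) (k : Fin (e + 2)) :
    transverse A k 0 = 0 := by
  induction k using Fin.cases with
  | zero => rfl
  | succ k => induction k using Fin.cases <;> rfl

@[simp] lemma transverse_one_right (A : Matrix (Fin e) (Fin e) ℝ) (k : Fin (e + 2)) :
    transverse A k 1 = 0 := by
  induction k using Fin.cases with
  | zero => rfl
  | succ k => induction k using Fin.cases <;> rfl

@[simp] lemma transverse_succ_succ (A : Matrix (Fin e) (Fin e) ℝ) (a b : Fin e) :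
    transverse A a.succ.succ b.succ.succ = A a b := rfl

/-- The curvature-type tensor with `R_{uiuj} = A_{ij}` as its only independent components. -/
def waveCurv (A : Matrix (Fin e) (Fin e) ℝ) (idx : Fin 4 → Fin (e + 2)) : ℝ :=
  (if idx 0 = 0 ∧ idx 2 = 0 then transverse A (idx 1) (idx 3) else 0)
  - (if idx 0 = 0 ∧ idx 3 = 0 then transverse A (idx 1) (idx 2) else 0)
  - (if idx 1 = 0 ∧ idx 2 = 0 then transverse A (idx 0) (idx 3) else 0)
  + (if idx 1 = 0 ∧ idx 3 = 0 then transverse A (idx 0) (idx 2) else 0)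

/-- The Hessian of the profile in the transverse and `v` directions. -/
lemma pd_pd_waveProfile_eq_transverse (hP : ∀ i j, ContDiff ℝ (⊤ : ℕ∞) fun u => P u i j)
    (hPsym : ∀ u, (P u).IsSymm) (x : Fin (e + 2) → ℝ) {i k : Fin (e + 2)}
    (hi : i ≠ 0) (hk : k ≠ 0) :
    pd i (pd k (waveProfile P)) x = transverse ((2 : ℝ) • P (x 0)) k i := by
  obtain ⟨i, rfl⟩ := Fin.exists_succ_eq.mpr hi
  obtain ⟨k, rfl⟩ := Fin.exists_succ_eq.mpr hk
  induction k using Fin.cases with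
  | zero =>
    simp only [Fin.succ_zero_eq_one, pd_waveProfile_one hP, pd_const, transverse_one_left]
  | succ k => induction i using Fin.cases with
    | zero =>
      rw [pd_comm (contDiff_waveProfile hP)]
      simp only [Fin.succ_zero_eq_one, pd_waveProfile_one hP, pd_const, transverse_one_right]
    | succ i => simp [pd_pd_waveProfile hP hPsym]

lemma curvUp_zero (hP : ∀ i j, ContDiff ℝ (⊤ : ℕ∞) fun u => P u i j)
    (x : Fin (e + 2) → ℝ) (k i j : Fin (e + 2)) : curvUp (cwMetric e P) x 0 k i j = 0 := by
  simp [curvUp, christoffel_zero hP, pd_const]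

lemma curvUp_one (hP : ∀ i j, ContDiff ℝ (⊤ : ℕ∞) fun u => P u i j)
    (hPsym : ∀ u, (P u).IsSymm) (x : Fin (e + 2) → ℝ) (k i j : Fin (e + 2)) :
    curvUp (cwMetric e P) x 1 k i j
      = (if j = 0 then transverse ((2 : ℝ) • P (x 0)) k i else 0)
        - if i = 0 then transverse ((2 : ℝ) • P (x 0)) k j else 0 := by
  have hH := contDiff_waveProfile hP
  have hd (a : Fin (e + 2)) : DifferentiableAt ℝ (pd a (waveProfile P)) x :=
    ((hH.pd a).differentiable (by simp)).differentiableAt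
  have hd' (p : Prop) [Decidable p] (a : Fin (e + 2)) :
      DifferentiableAt ℝ (fun y => if p then pd a (waveProfile P) y else 0) x := by
    split_ifs
    exacts [hd a, differentiableAt_const _]
  have hquad (i j : Fin (e + 2)) :
      ∑ m, christoffel (cwMetric e P) x 1 i m * christoffel (cwMetric e P) x m j k
        = if i = 0 ∧ j = 0 ∧ k = 0 then
            ∑ m : Fin e, pd m.succ.succ (waveProfile P) x * pd m.succ.succ (waveProfile P) x
          else 0 := by
    rw [Fin.sum_univ_succ, Fin.sum_univ_succ]
    simp only [christoffel_zero hP, christoffel_succ_succ hP, Fin.succ_zero_eq_one]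
    simp only [christoffel_one hP, pd_waveProfile_one hP]
    by_cases hi : i = 0 <;> by_cases hj : j = 0 <;> by_cases hk : k = 0 <;> simp [hi, hj, hk]
  have hder (i j : Fin (e + 2)) : pd i (fun y => christoffel (cwMetric e P) y 1 j k) x
      = (if k = 0 then pd i (pd j (waveProfile P)) x else 0)
        + (if j = 0 then pd i (pd k (waveProfile P)) x else 0)
        - (if j = 0 ∧ k = 0 then pd i (pd 0 (waveProfile P)) x else 0) := by
    simp only [christoffel_one hP]
    rw [pd_sub _ ((hd' _ _).fun_add (hd' _ _)) (hd' _ _), pd_add _ (hd' _ _) (hd' _ _),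
      pd_ite, pd_ite, pd_ite]
  simp only [curvUp, hquad, hder]
  rw [pd_comm hH j i]
  have hT (i : Fin (e + 2)) (hi : i ≠ 0) (hk : k ≠ 0) :=
    pd_pd_waveProfile_eq_transverse hP hPsym x hi hk
  by_cases hk : k = 0
  · subst hk
    by_cases hi : i = 0 <;> by_cases hj : j = 0 <;> simp [hi, hj]
  · by_cases hi : i = 0 <;> by_cases hj : j = 0 <;> simp [hi, hj, hk, hT]

lemma curvUp_succ_succ (hP : ∀ i j, ContDiff ℝ (⊤ : ℕ∞) fun u => P u i j)
    (hPsym : ∀ u, (P u).IsSymm) (x : Fin (e + 2) → ℝ) (s : Fin e) (k i j : Fin (e + 2)) :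
    curvUp (cwMetric e P) x s.succ.succ k i j
      = if k = 0 then (if j = 0 then transverse ((2 : ℝ) • P (x 0)) s.succ.succ i else 0)
          - if i = 0 then transverse ((2 : ℝ) • P (x 0)) s.succ.succ j else 0 else 0 := by
  have hquad (i j : Fin (e + 2)) :
      ∑ m, christoffel (cwMetric e P) x s.succ.succ i m * christoffel (cwMetric e P) x m j k
        = 0 := by
    rw [Fin.sum_univ_succ, christoffel_zero hP]
    simp [christoffel_succ_succ hP]
  have hT (i : Fin (e + 2)) (hi : i ≠ 0) :=
    pd_pd_waveProfile_eq_transverse hP hPsym x hi (Fin.succ_ne_zero s.succ)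
  rw [curvUp, hquad, hquad]
  simp only [christoffel_succ_succ hP, pd_ite]
  by_cases hk : k = 0 <;> by_cases hi : i = 0 <;> by_cases hj : j = 0 <;> simp [hi, hj, hk, hT]

lemma riemann_cwMetric (hP : ∀ i j, ContDiff ℝ (⊤ : ℕ∞) fun u => P u i j)
    (hPsym : ∀ u, (P u).IsSymm) (x : Fin (e + 2) → ℝ) (idx : Fin 4 → Fin (e + 2)) :
    riemann (cwMetric e P) x idx = waveCurv ((2 : ℝ) • P (x 0)) idx := by
  simp only [riemann, waveCurv]
  generalize idx 0 = l, idx 1 = k, idx 2 = i, idx 3 = j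
  induction l using Fin.cases with
  | zero =>
    rw [sum_cwMetric_zero, curvUp_zero hP, curvUp_one hP hPsym]
    by_cases hi : i = 0 <;> by_cases hj : j = 0 <;> simp [hi, hj]
  | succ l => induction l using Fin.cases with
    | zero =>
      rw [Fin.succ_zero_eq_one, sum_cwMetric_one, curvUp_zero hP]
      simp
    | succ l =>
      rw [sum_cwMetric_succ_succ, curvUp_succ_succ hP hPsym]
      by_cases hk : k = 0 <;> by_cases hi : i = 0 <;> by_cases hj : j = 0 <;> simp [hk, hi, hj]

/-- Smooth families of tensors depending only on `u`, annihilated by `∂_v` and invariant under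
the null rotations about `∂_v`. -/
structure IsWaveTensor {s : ℕ} (f : ℝ → (Fin s → Fin (e + 2)) → ℝ) : Prop where
  smooth : ∀ idx, ContDiff ℝ (⊤ : ℕ∞) fun u => f u idx
  eq_zero_of_one : ∀ u idx a, idx a = 1 → f u idx = 0
  null_rotation : ∀ u idx (k : Fin e),
    ∑ a, (if idx a = 0 then f u (Function.update idx a k.succ.succ) else 0) = 0

/-- The `u`-derivative of a tensor with a new first slot that is nonzero only on `∂_u`. -/
def waveDeriv {s : ℕ} (f : ℝ → (Fin s → Fin (e + 2)) → ℝ) (u : ℝ)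
    (idx : Fin (s + 1) → Fin (e + 2)) : ℝ :=
  if idx 0 = 0 then deriv (fun t => f t fun a => idx a.succ) u else 0

lemma covDeriv_cwMetric (hP : ∀ i j, ContDiff ℝ (⊤ : ℕ∞) fun u => P u i j) {s : ℕ}
    {f : ℝ → (Fin s → Fin (e + 2)) → ℝ} (hf : IsWaveTensor f) :
    covDeriv (cwMetric e P) (fun x => f (x 0)) = fun x => waveDeriv f (x 0) := by
  funext x idx
  have hcorr : ∑ a : Fin s, ∑ c, christoffel (cwMetric e P) x c (idx 0) (idx a.succ)
      * f (x 0) (Function.update (fun b : Fin s => idx b.succ) a c) = 0 := by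
    have hone (a : Fin s) : f (x 0) (Function.update (fun b : Fin s => idx b.succ) a 1) = 0 :=
      hf.eq_zero_of_one _ _ a (by simp)
    simp only [Fin.sum_univ_succ (n := e + 1), Fin.sum_univ_succ (n := e), christoffel_zero hP,
      Fin.succ_zero_eq_one, hone, christoffel_succ_succ hP, zero_mul, mul_zero, zero_add]
    rw [Finset.sum_comm]
    refine Finset.sum_eq_zero fun k _ => ?_
    by_cases h0 : idx 0 = 0
    · have h := congrArg (pd k.succ.succ (waveProfile P) x * ·)
        (hf.null_rotation (x 0) (fun b => idx b.succ) k)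
      simp only [Finset.mul_sum, mul_zero] at h
      refine (Finset.sum_congr rfl fun a _ => ?_).trans h
      by_cases ha : idx a.succ = 0 <;> simp [h0, ha]
    · simp [h0]
  rw [covDeriv, hcorr, sub_zero,
    pd_comp_coord (f := fun t => f t fun a => idx a.succ) _ _
      ((hf.smooth _).differentiable (by simp)).differentiableAt]
  simp [waveDeriv, eq_comm]

lemma IsWaveTensor.waveDeriv {s : ℕ} {f : ℝ → (Fin s → Fin (e + 2)) → ℝ}
    (hf : IsWaveTensor f) : IsWaveTensor (waveDeriv f) where
  smooth idx := by
    unfold _root_.waveDeriv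
    split_ifs
    · exact ((contDiff_infty_iff_deriv (𝕜 := ℝ)).mp (hf.smooth _)).2
    · exact contDiff_const
  eq_zero_of_one u idx a ha := by
    unfold _root_.waveDeriv
    induction a using Fin.cases with
    | zero => simp [ha]
    | succ a =>
      have h (t : ℝ) : f t (fun a => idx a.succ) = 0 := hf.eq_zero_of_one t _ a ha
      simp [h]
  null_rotation u idx k := by
    rw [Fin.sum_univ_succ]
    have hupd (a : Fin s) : (fun b : Fin s => Function.update idx a.succ k.succ.succ b.succ)
        = Function.update (fun b : Fin s => idx b.succ) a k.succ.succ := by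
      funext b
      simp [Function.update_apply]
    have hd (g : Fin s → Fin (e + 2)) : DifferentiableAt ℝ (fun t => f t g) u :=
      ((hf.smooth g).differentiable (by simp)).differentiableAt
    have hsum : ∑ a : Fin s, (if idx a.succ = 0 then
        deriv (fun t => f t (Function.update (fun b : Fin s => idx b.succ) a k.succ.succ)) u
        else 0) = 0 := by
      have h := congrArg (fun F => deriv F u)
        (funext fun t => hf.null_rotation t (fun b => idx b.succ) k)
      rw [deriv_fun_sum fun a _ => by split_ifs <;> simp [hd]] at h
      rw [deriv_const] at h
      refine (Finset.sum_congr rfl fun a _ => ?_).trans h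
      split_ifs <;> simp
    simp only [_root_.waveDeriv, hupd]
    by_cases h0 : idx 0 = 0
    · simpa [h0, (Fin.succ_ne_zero _).symm] using hsum
    · simp [h0, (Fin.succ_ne_zero _).symm]

lemma isWaveTensor_waveCurv {A : ℝ → Matrix (Fin e) (Fin e) ℝ}
    (hA : ∀ i j, ContDiff ℝ (⊤ : ℕ∞) fun u => A u i j) :
    IsWaveTensor fun u => waveCurv (A u) where
  smooth idx := by
    have ht (k l : Fin (e + 2)) : ContDiff ℝ (⊤ : ℕ∞) fun u => transverse (A u) k l := by
      induction k using Fin.cases with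
      | zero => exact contDiff_const
      | succ k => induction k using Fin.cases with
        | zero => exact contDiff_const
        | succ k => induction l using Fin.cases with
          | zero => exact contDiff_const
          | succ l => induction l using Fin.cases with
            | zero => exact contDiff_const
            | succ l => exact hA k l
    have hite (p : Prop) [Decidable p] (k l : Fin (e + 2)) :
        ContDiff ℝ (⊤ : ℕ∞) fun u => if p then transverse (A u) k l else 0 := by
      split_ifs
      exacts [ht k l, contDiff_const]
    exact (((hite _ _ _).sub (hite _ _ _)).sub (hite _ _ _)).add (hite _ _ _)
  eq_zero_of_one u idx a ha := by
    have h10 : (1 : Fin (e + 2)) ≠ 0 := by simp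
    unfold waveCurv
    fin_cases a <;> simp_all
  null_rotation u idx k := by
    have hk : k.succ.succ ≠ 0 := Fin.succ_ne_zero _
    simp only [Fin.sum_univ_four, waveCurv, Function.update_apply]
    generalize idx 0 = p, idx 1 = q, idx 2 = r, idx 3 = t
    by_cases hp : p = 0 <;> by_cases hq : q = 0 <;> by_cases hr : r = 0 <;>
      by_cases ht : t = 0 <;> simp [hp, hq, hr, ht, hk]

lemma riemann_cwMetric_eq_zero (hP : ∀ i j, ContDiff ℝ (⊤ : ℕ∞) fun u => P u i j)
    (hPsym : ∀ u, (P u).IsSymm) (x : Fin (e + 2) → ℝ) (idx : Fin 4 → Fin (e + 2))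
    (h : ¬ (((idx 0 = 0 ∧ 2 ≤ ((idx 1 : Fin (e + 2)) : ℕ))
            ∨ (idx 1 = 0 ∧ 2 ≤ ((idx 0 : Fin (e + 2)) : ℕ)))
          ∧ ((idx 2 = 0 ∧ 2 ≤ ((idx 3 : Fin (e + 2)) : ℕ))
            ∨ (idx 3 = 0 ∧ 2 ≤ ((idx 2 : Fin (e + 2)) : ℕ))))) :
    riemann (cwMetric e P) x idx = 0 := by
  rw [riemann_cwMetric hP hPsym, waveCurv]
  have hl (A : Matrix (Fin e) (Fin e) ℝ) (k l : Fin (e + 2)) (hk : ¬ 2 ≤ (k : ℕ)) :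
      transverse A k l = 0 := by
    obtain rfl | rfl : k = 0 ∨ k = 1 := by simp only [Fin.ext_iff, Fin.val_zero, Fin.val_one]; omega
    exacts [transverse_zero_left A l, transverse_one_left A l]
  have hr (A : Matrix (Fin e) (Fin e) ℝ) (k l : Fin (e + 2)) (hk : ¬ 2 ≤ (l : ℕ)) :
      transverse A k l = 0 := by
    obtain rfl | rfl : l = 0 ∨ l = 1 := by simp only [Fin.ext_iff, Fin.val_zero, Fin.val_one]; omega
    exacts [transverse_zero_right A k, transverse_one_right A k]
  generalize idx 0 = p, idx 1 = q, idx 2 = r, idx 3 = t at h ⊢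
  generalize (2 : ℝ) • P (x 0) = A
  have hl' := hl A
  have hr' := hr A
  grind

lemma contDiff_two_smul {A : ℝ → Matrix (Fin e) (Fin e) ℝ}
    (hA : ∀ i j, ContDiff ℝ (⊤ : ℕ∞) fun u => A u i j) (i j : Fin e) :
    ContDiff ℝ (⊤ : ℕ∞) fun u => ((2 : ℝ) • A u) i j :=
  contDiff_const.mul (hA i j)

/-- The entrywise derivative of a matrix-valued function. -/
def entryDeriv (A : ℝ → Matrix (Fin e) (Fin e) ℝ) (u : ℝ) : Matrix (Fin e) (Fin e) ℝ :=
  Matrix.of fun i j => deriv (fun t => A t i j) u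

lemma contDiff_entryDeriv {A : ℝ → Matrix (Fin e) (Fin e) ℝ}
    (hA : ∀ i j, ContDiff ℝ (⊤ : ℕ∞) fun u => A u i j) (i j : Fin e) :
    ContDiff ℝ (⊤ : ℕ∞) fun u => entryDeriv A u i j :=
  (contDiff_infty_iff_deriv.mp (hA i j)).2

lemma entryDeriv_two_smul (u : ℝ) :
    entryDeriv (fun t => (2 : ℝ) • P t) u = (2 : ℝ) • entryDeriv P u := by
  ext i j
  simp [entryDeriv]

lemma deriv_waveCurv {A : ℝ → Matrix (Fin e) (Fin e) ℝ}
    (hA : ∀ i j, ContDiff ℝ (⊤ : ℕ∞) fun u => A u i j) (idx : Fin 4 → Fin (e + 2)) (u : ℝ) :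
    deriv (fun t => waveCurv (A t) idx) u = waveCurv (entryDeriv A u) idx := by
  have ht (k l : Fin (e + 2)) :
      HasDerivAt (fun u => transverse (A u) k l) (transverse (entryDeriv A u) k l) u := by
    induction k using Fin.cases with
    | zero => exact hasDerivAt_const _ _
    | succ k => induction k using Fin.cases with
      | zero => exact hasDerivAt_const _ _
      | succ k => induction l using Fin.cases with
        | zero => exact hasDerivAt_const _ _
        | succ l => induction l using Fin.cases with
          | zero => exact hasDerivAt_const _ _
          | succ l => exact ((hA k l).differentiable (by simp) u).hasDerivAt
  have hite (p : Prop) [Decidable p] (k l : Fin (e + 2)) :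
      HasDerivAt (fun u => if p then transverse (A u) k l else 0)
        (if p then transverse (entryDeriv A u) k l else 0) u := by
    split_ifs
    exacts [ht k l, hasDerivAt_const _ _]
  exact ((((hite _ _ _).sub (hite _ _ _)).sub (hite _ _ _)).add (hite _ _ _)).deriv

@[simp] lemma waveCurv_zero (idx : Fin 4 → Fin (e + 2)) : waveCurv 0 idx = 0 := by
  have ht (k l : Fin (e + 2)) : transverse (0 : Matrix (Fin e) (Fin e) ℝ) k l = 0 := by
    induction k using Fin.cases with
    | zero => rfl
    | succ k => induction k using Fin.cases with
      | zero => rfl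
      | succ k => induction l using Fin.cases with
        | zero => rfl
        | succ l => induction l using Fin.cases <;> rfl
  simp [waveCurv, ht]

lemma waveCurv_zero_succ_zero_succ (A : Matrix (Fin e) (Fin e) ℝ) (i j : Fin e) :
    waveCurv A ![0, i.succ.succ, 0, j.succ.succ] = A i j := by
  simp [waveCurv]

lemma nablaR_one (hP : ∀ i j, ContDiff ℝ (⊤ : ℕ∞) fun u => P u i j)
    (hPsym : ∀ u, (P u).IsSymm) :
    nablaR (cwMetric e P) 1 = fun x => waveDeriv (fun u => waveCurv ((2 : ℝ) • P u)) (x 0) := by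
  have h0 : nablaR (cwMetric e P) 0 = fun x => waveCurv ((2 : ℝ) • P (x 0)) :=
    funext fun x => funext fun idx => riemann_cwMetric hP hPsym x idx
  rw [nablaR, h0]
  exact covDeriv_cwMetric hP (isWaveTensor_waveCurv (contDiff_two_smul hP))

lemma nablaR_two (hP : ∀ i j, ContDiff ℝ (⊤ : ℕ∞) fun u => P u i j)
    (hPsym : ∀ u, (P u).IsSymm) :
    nablaR (cwMetric e P) 2
      = fun x => waveDeriv (waveDeriv fun u => waveCurv ((2 : ℝ) • P u)) (x 0) := by
  rw [nablaR, nablaR_one hP hPsym]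
  exact covDeriv_cwMetric hP
    (isWaveTensor_waveCurv (contDiff_two_smul hP)).waveDeriv

lemma waveDeriv_waveCurv (hP : ∀ i j, ContDiff ℝ (⊤ : ℕ∞) fun u => P u i j) (u : ℝ)
    (idx : Fin 5 → Fin (e + 2)) :
    waveDeriv (fun u => waveCurv ((2 : ℝ) • P u)) u idx
      = if idx 0 = 0 then waveCurv ((2 : ℝ) • entryDeriv P u) fun a => idx a.succ else 0 := by
  rw [waveDeriv, deriv_waveCurv (contDiff_two_smul hP), entryDeriv_two_smul]

lemma waveDeriv_waveDeriv_waveCurv (hP : ∀ i j, ContDiff ℝ (⊤ : ℕ∞) fun u => P u i j) (u : ℝ)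
    (idx : Fin 6 → Fin (e + 2)) :
    waveDeriv (waveDeriv fun u => waveCurv ((2 : ℝ) • P u)) u idx
      = if idx 0 = 0 ∧ idx 1 = 0 then
          waveCurv ((2 : ℝ) • entryDeriv (entryDeriv P) u) fun a => idx a.succ.succ
        else 0 := by
  rw [waveDeriv]
  simp only [waveDeriv_waveCurv hP]
  by_cases h1 : idx 1 = 0
  · simp only [Fin.succ_zero_eq_one, h1, if_true, and_true]
    rw [deriv_waveCurv (contDiff_two_smul (contDiff_entryDeriv hP)),
      entryDeriv_two_smul]
  · simp [h1]

lemma rthSymmetricOn_one_iff (hP : ∀ i j, ContDiff ℝ (⊤ : ℕ∞) fun u => P u i j)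
    (hPsym : ∀ u, (P u).IsSymm) :
    RthSymmetricOn (cwMetric e P) Set.univ 1 ↔ ∀ u, entryDeriv P u = 0 := by
  rw [RthSymmetricOn, nablaR_one hP hPsym]
  constructor
  · intro h u
    ext i j
    have h' := h (fun _ => u) trivial ![0, 0, i.succ.succ, 0, j.succ.succ]
    have hidx : (fun a : Fin 4 => (![0, 0, i.succ.succ, 0, j.succ.succ] : Fin 5 → _) a.succ)
        = ![0, i.succ.succ, 0, j.succ.succ] := rfl
    beta_reduce at h'
    rw [waveDeriv_waveCurv hP, hidx, waveCurv_zero_succ_zero_succ] at h'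
    simpa using h'
  · intro h x _ idx
    exact (waveDeriv_waveCurv hP _ _).trans (by simp [h])

lemma rthSymmetricOn_two_iff (hP : ∀ i j, ContDiff ℝ (⊤ : ℕ∞) fun u => P u i j)
    (hPsym : ∀ u, (P u).IsSymm) :
    RthSymmetricOn (cwMetric e P) Set.univ 2 ↔ ∀ u, entryDeriv (entryDeriv P) u = 0 := by
  rw [RthSymmetricOn, nablaR_two hP hPsym]
  constructor
  · intro h u
    ext i j
    have h' := h (fun _ => u) trivial ![0, 0, 0, i.succ.succ, 0, j.succ.succ]
    have hidx : (fun a : Fin 4 =>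
        (![0, 0, 0, i.succ.succ, 0, j.succ.succ] : Fin 6 → _) a.succ.succ)
        = ![0, i.succ.succ, 0, j.succ.succ] := rfl
    beta_reduce at h'
    rw [waveDeriv_waveDeriv_waveCurv hP, hidx, waveCurv_zero_succ_zero_succ] at h'
    simpa using h'
  · intro h x _ idx
    exact (waveDeriv_waveDeriv_waveCurv hP _ _).trans (by simp [h])

lemma entryDeriv_affine (α β : Matrix (Fin e) (Fin e) ℝ) :
    entryDeriv (fun u => u • α + β) = fun _ => α := by
  funext u
  ext i j
  simp [entryDeriv]

lemma entryDeriv_const (α : Matrix (Fin e) (Fin e) ℝ) : entryDeriv (fun _ => α) = fun _ => 0 := by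
  funext u
  ext i j
  simp [entryDeriv]

/-- A matrix-valued function with vanishing second derivative is affine. -/
lemma eq_affine_of_entryDeriv_entryDeriv (hP : ∀ i j, ContDiff ℝ (⊤ : ℕ∞) fun u => P u i j)
    (h : ∀ u, entryDeriv (entryDeriv P) u = 0) (u : ℝ) : P u = u • entryDeriv P 0 + P 0 := by
  ext i j
  have hd := (hP i j).differentiable (by simp)
  have h1 (t : ℝ) : deriv (fun t => P t i j) t = entryDeriv P 0 i j :=
    is_const_of_deriv_eq_zero ((contDiff_entryDeriv hP i j).differentiable (by simp))
      (fun t => congrFun (congrFun (h t) i) j) t 0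
  have h2 := is_const_of_deriv_eq_zero (f := fun t => P t i j - t * entryDeriv P 0 i j)
    (by fun_prop) (fun t => by
      rw [deriv_fun_sub (hd t) (by fun_prop), h1]
      simp) u 0
  simp only [zero_mul, sub_zero] at h2
  simp only [Matrix.add_apply, Matrix.smul_apply, smul_eq_mul]
  linarith

lemma sum_sq_ne_zero_iff (α : Matrix (Fin e) (Fin e) ℝ) :
    ∑ i, ∑ j, (α i j) ^ 2 ≠ 0 ↔ α ≠ 0 := by
  refine not_congr ⟨fun h => ?_, fun h => by simp [h]⟩
  ext i j
  have hi := (Finset.sum_eq_zero_iff_of_nonneg fun i _ =>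
    Finset.sum_nonneg fun j _ => sq_nonneg (α i j)).mp h i (Finset.mem_univ _)
  have hij := (Finset.sum_eq_zero_iff_of_nonneg fun j _ => sq_nonneg (α i j)).mp hi j
    (Finset.mem_univ _)
  simpa using hij

end PlaneWave

/-!
## STATEMENT 10
For the plane-wave metric `g = -2du(dv + p_{ij}(u)xⁱxʲ du) + δ_{ij}dxⁱdxʲ` on
`ℝ^{d+2}` (here `d = e ≥ 1` spatial dimensions, coordinates `x 0 = u`, `x 1 = v`,
spatial `x i.succ.succ`):
* the only possibly non-vanishing components of the Riemann tensor in the coordinate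
  frame are, up to the symmetries of the curvature tensor, `R_{uiuj} = 2p_{ij}(u)`;
* the spacetime is proper second-order symmetric (`∇∇R = 0`, `∇R ≠ 0`) iff every
  `p_{ij}` is affine, `p_{ij}(u) = α_{ij}u + β_{ij}`, with `Σ_{i,j} α_{ij}² ≠ 0`.
-/
theorem plane_wave_curvature_and_proper_second_symmetry
    (e : ℕ) (he : 1 ≤ e)
    (P : ℝ → Matrix (Fin e) (Fin e) ℝ)
    (hP : ∀ i j, ContDiff ℝ (⊤ : ℕ∞) fun u => P u i j)
    (hPsym : ∀ u, (P u).IsSymm) :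
    -- all components not of `R_{uiuj}` type (up to curvature symmetries) vanish
    (∀ (x : Fin (e + 2) → ℝ) (idx : Fin 4 → Fin (e + 2)),
      ¬ (((idx 0 = 0 ∧ 2 ≤ ((idx 1 : Fin (e + 2)) : ℕ))
            ∨ (idx 1 = 0 ∧ 2 ≤ ((idx 0 : Fin (e + 2)) : ℕ)))
          ∧ ((idx 2 = 0 ∧ 2 ≤ ((idx 3 : Fin (e + 2)) : ℕ))
            ∨ (idx 3 = 0 ∧ 2 ≤ ((idx 2 : Fin (e + 2)) : ℕ)))) →
        riemann (cwMetric e P) x idx = 0) ∧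
    -- the surviving components are `R_{uiuj} = 2 p_{ij}(u)`
    (∀ (x : Fin (e + 2) → ℝ) (i j : Fin e),
      riemann (cwMetric e P) x ![0, i.succ.succ, 0, j.succ.succ] = 2 * P (x 0) i j) ∧
    -- characterization of proper second-order symmetry
    ((RthSymmetricOn (cwMetric e P) Set.univ 2 ∧
        ¬ RthSymmetricOn (cwMetric e P) Set.univ 1)
      ↔ ∃ α β : Matrix (Fin e) (Fin e) ℝ,
          (∀ u, P u = u • α + β) ∧ (∑ i, ∑ j, (α i j) ^ 2) ≠ 0) := by
  refine ⟨riemann_cwMetric_eq_zero hP hPsym, fun x i j => ?_, ?_⟩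
  · rw [riemann_cwMetric hP hPsym, waveCurv_zero_succ_zero_succ]
    rfl
  rw [rthSymmetricOn_two_iff hP hPsym, rthSymmetricOn_one_iff hP hPsym]
  constructor
  · rintro ⟨h2, h1⟩
    have haff := eq_affine_of_entryDeriv_entryDeriv hP h2
    refine ⟨entryDeriv P 0, P 0, haff, (sum_sq_ne_zero_iff _).mpr fun h0 => h1 fun u => ?_⟩
    have hconst : P = fun _ => P 0 := funext fun u => by rw [haff u, h0, smul_zero, zero_add]
    rw [hconst, entryDeriv_const]
  · rintro ⟨α, β, haff, hα⟩
    have hD : entryDeriv P = fun _ => α := by rw [funext haff, entryDeriv_affine]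
    rw [hD, entryDeriv_const]
    exact ⟨fun _ => rfl, fun h => (sum_sq_ne_zero_iff α).mp hα (h 0)⟩
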